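/- Let v = p^n where p is a prime and n ≥ 1, let k ≥ 3, and for r = 1, 2 let S_r ⊆ Z_v satisfy |S_r| = k and |S_r − S_r| = k² − k + 1 (so that S_r is a base line of a balanced cyclic configuration of type (v_k)). Then the configurations Conf(Z_v, S₁) and Conf(Z_v, S₂) are isomorphic if and only if they are multiplier equivalent, i.e., if and only if there exist a unit a ∈ Z_v* and b ∈ Z_v such that S₁ = aS₂ + b. -/

import Mathlib

open scoped Pointwise

/-- The line set of the cyclic configuration `Conf(Z_v, S)`: the translates `S + i`. -/
def confLines (v : ℕ) (S : Finset (ZMod v)) : Set (Finset (ZMod v)) :=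
  {B | ∃ i : ZMod v, B = S.image (· + i)}

/-- Two cyclic configurations are isomorphic if some bijection of `ZMod v` maps the
line set of the first onto the line set of the second. -/
def ConfIso (v : ℕ) (S₁ S₂ : Finset (ZMod v)) : Prop :=
  ∃ σ : Equiv.Perm (ZMod v),
    (fun B : Finset (ZMod v) => B.image σ) '' confLines v S₁ = confLines v S₂

/-- Multiplier equivalence: `S₁ = a S₂ + b` for a unit `a` and some `b`. -/
def MultEquiv (v : ℕ) (S₁ S₂ : Finset (ZMod v)) : Prop :=
  ∃ a : (ZMod v)ˣ, ∃ b : ZMod v, S₁ = S₂.image (fun x => (a : ZMod v) * x + b)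

section Ring

variable {p n : ℕ}

lemma ZMod.isNilpotent_natCast_prime_pow (p n : ℕ) : IsNilpotent (p : ZMod (p ^ n)) :=
  ⟨n, by rw [← Nat.cast_pow, ZMod.natCast_self]⟩

/-- A `p`-th root of unity close to `1` differs from `1` by a `p`-torsion element. -/
lemma natCast_mul_eq_zero_of_one_add_pow_eq_one {R : Type*} [CommRing R] (hp : p.Prime)
    (hnil : IsNilpotent (p : R)) {y : R} (hy : (p : R) ∣ y) (hy4 : p = 2 → (4 : R) ∣ y)
    (h : (1 + y) ^ p = 1) : (p : R) * y = 0 := by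
  have hdvd : (p : R) * y * p ∣ y ^ p := by
    rcases hp.eq_two_or_odd' with rfl | hodd
    · obtain ⟨w, rfl⟩ := hy4 rfl
      exact ⟨w, by push_cast; ring⟩
    · have h3 : 3 ≤ p := by
        have := hp.two_le
        obtain ⟨r, rfl⟩ := hodd
        omega
      obtain ⟨w, rfl⟩ := hy
      refine Dvd.dvd.trans ⟨w ^ 2, ?_⟩ (pow_dvd_pow _ h3)
      ring
  obtain ⟨z, hz⟩ := ZMod.exists_one_add_mul_pow_prime_eq hp hy hdvd 1
  rw [mul_one, h, left_eq_add] at hz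
  exact ((((Commute.all (p : R) z).isNilpotent_mul_right hnil).isUnit_one_add).mul_left_eq_zero).1 hz

lemma ZMod.natCast_dvd_sub_one_of_pow_eq_one [Fact p.Prime] (hn : n ≠ 0) {u : ZMod (p ^ n)} {m : ℕ}
    (hu : u ^ p ^ m = 1) : (p : ZMod (p ^ n)) ∣ u - 1 := by
  have hdvd : p ∣ p ^ n := dvd_pow_self p hn
  have h1 : ZMod.castHom hdvd (ZMod p) u = 1 := by
    rw [← ZMod.pow_card_pow (n := m) (ZMod.castHom hdvd (ZMod p) u), ← map_pow, hu, map_one]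
  have h2 : u - 1 ∈ RingHom.ker (ZMod.castHom hdvd (ZMod p)) := by
    rw [RingHom.mem_ker, map_sub, h1, map_one, sub_self]
  obtain ⟨z, hz⟩ := ZMod.intCast_surjective (u - 1)
  rw [RingHom.mem_ker, ← hz, map_intCast, ZMod.intCast_zmod_eq_zero_iff_dvd] at h2
  obtain ⟨w, rfl⟩ := h2
  exact ⟨w, by rw [← hz]; push_cast; rfl⟩

/-- A unit of `p`-power order none of whose powers is a nontrivial unit congruent to `1` modulo
`p ^ (n - 1)` is trivial, except possibly if `p = 2`. -/
lemma ZMod.eq_one_or_of_pow_eq_one (hp : p.Prime) (hn : n ≠ 0) {u : ZMod (p ^ n)} {m : ℕ}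
    (hu : u ^ p ^ m = 1)
    (h : ∀ i : ℕ, (p : ZMod (p ^ n)) * (u ^ i - 1) = 0 → u ^ i = 1) :
    u = 1 ∨ p = 2 ∧ u ^ 2 = 1 ∧ 2 * (u + 1) = 0 := by
  have := Fact.mk hp
  have key : ∀ (m : ℕ) (u : ZMod (p ^ n)), u ^ p ^ m = 1 → (p = 2 → 4 ∣ u - 1) →
      (∀ i : ℕ, (p : ZMod (p ^ n)) * (u ^ i - 1) = 0 → u ^ i = 1) → u = 1 := by
    intro m
    induction m with
    | zero => intro u hu _ _; simpa using hu
    | succ m ih =>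
      intro u hu h4 h
      have hup : u ^ p = 1 := by
        refine ih (u ^ p) (by rw [← pow_mul, ← pow_succ', hu]) (fun h2 => (h4 h2).trans ?_)
          fun i hi => ?_
        · simpa using sub_dvd_pow_sub_pow u 1 p
        · rw [← pow_mul] at hi ⊢
          exact h _ hi
      have := natCast_mul_eq_zero_of_one_add_pow_eq_one hp (ZMod.isNilpotent_natCast_prime_pow p n)
        (ZMod.natCast_dvd_sub_one_of_pow_eq_one hn hu) h4 (by rwa [add_sub_cancel])
      simpa using h 1 (by simpa using this)
  by_cases hp2 : p = 2
  swap
  · exact Or.inl (key m u hu (fun h2 => absurd h2 hp2) h)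
  subst hp2
  obtain ⟨a, ha⟩ := ZMod.natCast_dvd_sub_one_of_pow_eq_one hn hu
  obtain ⟨z, rfl⟩ := ZMod.intCast_surjective a
  have hu' : u = 1 + 2 * (z : ZMod (2 ^ n)) := by push_cast at ha; linear_combination ha
  rcases Int.even_or_odd' z with ⟨w, rfl | rfl⟩
  · refine Or.inl (key m u hu (fun _ => ⟨w, ?_⟩) h)
    rw [hu']; push_cast; ring
  · have hsq : u ^ 2 = 1 := by
      refine key m (u ^ 2) (by rw [← pow_mul, mul_comm, pow_mul, hu, one_pow])
        (fun _ => ⟨(2 * w + 1) ^ 2 + (2 * w + 1), ?_⟩) fun i hi => ?_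
      · rw [hu']; push_cast; ring
      · rw [← pow_mul] at hi ⊢
        exact h _ hi
    refine Or.inr ⟨rfl, hsq, ?_⟩
    have hunit : IsUnit (1 + (2 : ZMod (2 ^ n)) * w) := by
      have h2 := ZMod.isNilpotent_natCast_prime_pow 2 n
      push_cast at h2
      exact ((Commute.all 2 (w : ZMod (2 ^ n))).isNilpotent_mul_right h2).isUnit_one_add
    refine (hunit.mul_left_eq_zero).1 ?_
    push_cast at hu'
    linear_combination hsq - (u + 1) * hu'

lemma ZMod.dvd_of_natCast_mul_eq_zero (hp : p.Prime) {w c : ZMod (p ^ n)} (hw : w ≠ 0)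
    (hc : (p : ZMod (p ^ n)) * c = 0) : w ∣ c := by
  obtain ⟨d, hd, u, hu, rfl⟩ := w.eq_unit_mul_divisor
  obtain ⟨z, rfl⟩ := ZMod.intCast_surjective c
  obtain ⟨l, hl, rfl⟩ := (Nat.dvd_prime_pow hp).1 hd
  have hln : l < n := lt_of_le_of_ne hl fun h => hw (by rw [h, ZMod.natCast_self, mul_zero])
  rw [← Int.cast_natCast, ← Int.cast_mul, ZMod.intCast_zmod_eq_zero_iff_dvd] at hc
  obtain ⟨r, rfl⟩ := Nat.exists_eq_succ_of_ne_zero (Nat.ne_zero_of_lt hln)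
  rw [Nat.succ_eq_add_one, pow_succ', Nat.cast_mul,
    Int.mul_dvd_mul_iff_left (by exact_mod_cast hp.ne_zero)] at hc
  have hlz : ((p ^ l : ℕ) : ℤ) ∣ z :=
    dvd_trans (by exact_mod_cast pow_dvd_pow p (Nat.lt_succ_iff.1 hln)) hc
  rw [hu.mul_left_dvd]
  simpa using map_dvd (Int.castRingHom (ZMod (p ^ r.succ))) hlz

end Ring

section DistinctDifferences

variable {G : Type*} [AddCommGroup G]

/-- The nonzero differences of elements of `S` are pairwise distinct. -/
def HasDistinctDifferences (S : Finset G) : Prop :=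
  ∀ a ∈ S, ∀ b ∈ S, ∀ c ∈ S, ∀ d ∈ S, a ≠ b → a - b = c - d → a = c ∧ b = d

lemma hasDistinctDifferences_of_card_sub [DecidableEq G] {S : Finset G} {k : ℕ}
    (hS : S.card = k) (hdiff : (S - S).card = k ^ 2 - k + 1) : HasDistinctDifferences S := by
  have hsub : S - S ⊆ insert 0 (S.offDiag.image fun x => x.1 - x.2) := by
    intro x hx
    obtain ⟨a, ha, b, hb, rfl⟩ := Finset.mem_sub.1 hx
    by_cases hab : a = b
    · simp [hab]
    · exact Finset.mem_insert_of_mem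
        (Finset.mem_image.2 ⟨(a, b), Finset.mem_offDiag.2 ⟨ha, hb, hab⟩, rfl⟩)
  have h1 := (Finset.card_le_card hsub).trans (Finset.card_insert_le _ _)
  have h2 : S.offDiag.card = k ^ 2 - k := by rw [Finset.offDiag_card, hS, sq]
  have hinj := Finset.card_image_iff.1
    (le_antisymm (Finset.card_image_le (s := S.offDiag) (f := fun x => x.1 - x.2)) (by omega))
  intro a ha b hb c hc d hd hab h
  have hcd : c ≠ d := by
    rintro rfl
    exact hab (sub_eq_zero.1 (h.trans (sub_self _)))
  have := @hinj (a, b) (Finset.mem_coe.2 (Finset.mem_offDiag.2 ⟨ha, hb, hab⟩))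
    (c, d) (Finset.mem_coe.2 (Finset.mem_offDiag.2 ⟨hc, hd, hcd⟩)) h
  exact Prod.ext_iff.1 this

lemma IsAddCyclic.card_nsmul_eq_le [DecidableEq G] [Fintype G] [IsAddCyclic G] {m : ℕ}
    (hm : 0 < m) (d₀ : G) : (Finset.univ.filter fun d : G => m • d = m • d₀).card ≤ m := by
  refine le_trans (Finset.card_le_card_of_injOn (· - d₀) (fun d hd => ?_)
    (sub_left_injective.injOn)) (IsAddCyclic.card_nsmul_eq_zero_le (α := G) hm)
  simpa [smul_sub, sub_eq_zero] using hd

/-- A cyclic group has no relative difference set with parameters `(p, p, p, 1)` for odd `p`: the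
image of `S` in the quotient by the `p`-torsion is not invariant under a nontrivial translation. -/
lemma HasDistinctDifferences.eq_zero_of_nsmul_perm [Finite G] [IsAddCyclic G] {S : Finset G}
    (hS : HasDistinctDifferences S) (hk : 3 ≤ S.card) {p : ℕ} (hp : p.Prime)
    (hG : ∀ x : G, ∃ m : ℕ, p ^ m • x = 0)
    {f : G → G} (hf : Set.BijOn f S S) {e : G} (he : ∀ s ∈ S, p • f s = p • s + e) : e = 0 := by
  classical
  have := Fintype.ofFinite G
  by_contra hne
  have hsum : ∑ s ∈ S, f s = ∑ s ∈ S, s := Finset.sum_nbij f hf.mapsTo hf.injOn hf.surjOn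
    fun _ _ => rfl
  have hke : S.card • e = 0 := by
    have h := Finset.sum_congr rfl he
    rwa [Finset.sum_add_distrib, ← Finset.smul_sum, ← Finset.smul_sum, hsum, Finset.sum_const,
      left_eq_add] at h
  have hpk : p ∣ S.card := by
    by_contra hpk
    obtain ⟨m, hm⟩ := hG e
    exact hne (by simpa [((hp.coprime_pow_of_not_dvd hpk)).gcd_eq_one] using
      gcd_nsmul_eq_zero.2 ⟨hke, hm⟩)
  obtain ⟨s₀, hs₀⟩ := Finset.card_pos.1 (by omega : 0 < S.card)
  have hne' : ∀ s ∈ S, f s ≠ s := fun s hs h => hne (by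
    have := he s hs
    rwa [h, left_eq_add] at this)
  set d₀ := f s₀ - s₀ with hd₀
  have hd : ∀ s ∈ S, p • (f s - s) = p • d₀ := by
    intro s hs
    rw [hd₀, smul_sub, smul_sub, he s hs, he s₀ hs₀, add_sub_cancel_left, add_sub_cancel_left]
  have hinj : Set.InjOn (fun s => f s - s) S := fun s hs t ht h =>
    (hS _ (hf.mapsTo hs) _ hs _ (hf.mapsTo ht) _ ht (hne' s hs) h).2
  have himage : S.image (fun s => f s - s) ⊆ Finset.univ.filter fun d => p • d = p • d₀ := by
    intro x hx
    obtain ⟨s, hs, rfl⟩ := Finset.mem_image.1 hx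
    simpa using hd s hs
  have hle := Nat.le_of_dvd (by omega) hpk
  have hcard := Finset.card_image_of_injOn hinj
  have hD := IsAddCyclic.card_nsmul_eq_le hp.pos d₀
  have heq := Finset.eq_of_subset_of_card_le himage (by omega)
  have hSp : S.card = p := by rw [heq] at hcard; omega
  have h0 : ∑ d ∈ Finset.univ.filter (fun d : G => p • d = p • d₀), d = 0 := by
    rw [← heq, Finset.sum_image hinj, Finset.sum_sub_distrib, hsum, sub_self]
  have hrefl : ∑ d ∈ Finset.univ.filter (fun d : G => p • d = p • d₀), (d₀ + d₀ - d) =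
      ∑ d ∈ Finset.univ.filter (fun d : G => p • d = p • d₀), d := by
    refine Finset.sum_nbij' (fun d => d₀ + d₀ - d) (fun d => d₀ + d₀ - d) ?_ ?_ ?_ ?_ ?_ <;>
      simp +contextual [smul_sub, smul_add]
  rw [Finset.sum_sub_distrib, h0, sub_zero, Finset.sum_const, ← heq, hcard, hSp, smul_add] at hrefl
  have hpd : p • d₀ = e := by rw [hd₀, smul_sub, he s₀ hs₀, add_sub_cancel_left]
  rw [hpd, ← two_nsmul] at hrefl
  rw [hSp] at hke hk
  refine hne (by simpa [((Nat.coprime_primes hp Nat.prime_two).2 (by omega)).gcd_eq_one] using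
      gcd_nsmul_eq_zero.2 ⟨hke, hrefl⟩)

end DistinctDifferences

section Configuration

/-- An automorphism of a connected balanced cyclic configuration that commutes with the
translations by `p`-torsion elements and fixes the cosets of the `p`-torsion is a translation. -/
lemma HasDistinctDifferences.exists_eq_add_of_nsmul_eq {G : Type*} [AddCommGroup G] [Finite G]
    [IsAddCyclic G] {S : Finset G} (hS : HasDistinctDifferences S) (hk : 3 ≤ S.card)
    (hconn : AddSubgroup.closure ((S : Set G) - (S : Set G)) = ⊤) {p : ℕ} (hp : p.Prime)
    (hG : ∀ x : G, ∃ m : ℕ, p ^ m • x = 0) {g : Equiv.Perm G}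
    (hg : ∀ i, ∃ j, ∀ x, x - i ∈ S ↔ g x - j ∈ S)
    (hcomm : ∀ x c, p • c = 0 → g (x + c) = g x + c) (hker : ∀ x, p • g x = p • x) :
    ∃ w, ∀ x, g x = x + w := by
  have hline : ∀ i, ∃ b, ∀ x, x - i ∈ S → g x - x = b := by
    intro i
    obtain ⟨j, hj⟩ := hg i
    have he : p • (i - j) = 0 := by
      refine hS.eq_zero_of_nsmul_perm (f := fun s => g (s + i) - j) hk hp hG ⟨?_, ?_, ?_⟩ ?_
      · intro s hs
        exact (hj (s + i)).1 (by simpa using hs)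
      · intro s _ t _ h
        simpa using h
      · intro s hs
        refine ⟨g.symm (s + j) - i, ?_, by simp⟩
        exact (hj _).2 (by simpa using hs)
      · intro s _
        rw [smul_sub, hker, smul_add, smul_sub]
        abel
    refine ⟨j - i, fun x hx => ?_⟩
    have hx' := (hj x).1 hx
    have hyx : p • (g x - j + i - x) = 0 := by
      rw [show g x - j + i - x = (g x - x) + (i - j) by abel, smul_add, he, smul_sub, hker,
        sub_self, add_zero]
    have hgy := hcomm x _ hyx
    have hy := (hj (x + (g x - j + i - x))).1 (by
      rwa [show x + (g x - j + i - x) - i = g x - j by abel])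
    rw [hgy] at hy
    by_contra hne
    have hne' : g x + (g x - j + i - x) - j ≠ g x - j := by
      intro h
      apply hne
      have h1 : g x - j + i - x = 0 := by
        rwa [add_sub_right_comm, add_eq_left] at h
      rw [← sub_eq_zero, ← h1]
      abel
    exact hne' (hS _ hy _ hx' _ hx' _ hx hne' (by abel)).1
  have hadd : ∀ h ∈ AddSubgroup.closure ((S : Set G) - (S : Set G)), ∀ x,
      g (x + h) - (x + h) = g x - x := by
    intro h hh
    induction hh using AddSubgroup.closure_induction with
    | mem h hh =>
      intro x
      obtain ⟨s, hs, t, ht, rfl⟩ := Set.mem_sub.1 hh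
      obtain ⟨b, hb⟩ := hline (x - t)
      rw [hb x (by simpa using ht), hb _ (by
        rwa [show x + (s - t) - (x - t) = s by abel])]
    | zero => simp
    | add a b _ _ ha hb => intro x; rw [← add_assoc, hb, ha]
    | neg a _ ha => intro x; rw [← ha (x + -a), neg_add_cancel_right]
  refine ⟨g 0, fun x => ?_⟩
  have := hadd x (hconn ▸ AddSubgroup.mem_top x) 0
  rw [zero_add, sub_zero] at this
  rw [← this, add_sub_cancel]

variable {v : ℕ}

lemma mem_image_add_right {S : Finset (ZMod v)} {i x : ZMod v} :
    x ∈ S.image (· + i) ↔ x - i ∈ S := by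
  simp [sub_eq_add_neg]

lemma exists_forall_sub_mem_iff {S₁ S₂ : Finset (ZMod v)} {σ : Equiv.Perm (ZMod v)}
    (h : σ • confLines v S₁ = confLines v S₂) (i : ZMod v) :
    ∃ j, ∀ x, x - i ∈ S₁ ↔ σ x - j ∈ S₂ := by
  have : σ • S₁.image (· + i) ∈ confLines v S₂ := h ▸ Set.smul_mem_smul_set ⟨i, rfl⟩
  obtain ⟨j, hj⟩ := this
  refine ⟨j, fun x => ?_⟩
  rw [← mem_image_add_right, ← mem_image_add_right, ← hj, ← Equiv.Perm.smul_def,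
    Finset.smul_mem_smul_finset_iff]

lemma smul_confLines_eq {S₁ S₂ : Finset (ZMod v)} {σ : Equiv.Perm (ZMod v)}
    (h : ∀ i, ∃ j, ∀ x, x - i ∈ S₁ ↔ σ x - j ∈ S₂)
    (h' : ∀ j, ∃ i, ∀ x, x - i ∈ S₁ ↔ σ x - j ∈ S₂) :
    σ • confLines v S₁ = confLines v S₂ := by
  have key : ∀ i j, (∀ x, x - i ∈ S₁ ↔ σ x - j ∈ S₂) →
      σ • S₁.image (· + i) = S₂.image (· + j) := by
    intro i j hij
    ext y
    rw [← Equiv.apply_symm_apply σ y, ← Equiv.Perm.smul_def σ, Finset.smul_mem_smul_finset_iff,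
      mem_image_add_right, Equiv.Perm.smul_def, mem_image_add_right, hij]
  ext B
  constructor
  · rintro ⟨_, ⟨i, rfl⟩, rfl⟩
    obtain ⟨j, hj⟩ := h i
    exact ⟨j, key i j hj⟩
  · rintro ⟨j, rfl⟩
    obtain ⟨i, hi⟩ := h' j
    exact ⟨_, ⟨i, rfl⟩, key i j hi⟩

lemma addRight_smul_confLines (S : Finset (ZMod v)) (w : ZMod v) :
    Equiv.addRight w • confLines v S = confLines v S :=
  smul_confLines_eq (fun i => ⟨i + w, fun x => by simp⟩)
    fun j => ⟨j - w, fun x => by simp [sub_sub_eq_add_sub]⟩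

lemma ZMod.eq_mul_add_of_map_add_one [NeZero v] {f : ZMod v → ZMod v} {w : ZMod v}
    (hf : ∀ x, f (x + 1) = f x + w) (x : ZMod v) : f x = w * x + f 0 := by
  have h : ∀ m : ℕ, f m = w * m + f 0 := by
    intro m
    induction m with
    | zero => simp
    | succ m ih => push_cast; rw [hf, ih]; ring
  simpa using h x.val

lemma ZMod.orderOf_addRight_one : orderOf (Equiv.addRight (1 : ZMod v)) = v := by
  refine Nat.dvd_antisymm (orderOf_dvd_of_pow_eq_one ?_) ?_
  · ext x; simp
  · rw [← ZMod.natCast_eq_zero_iff]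
    have h := pow_orderOf_eq_one (Equiv.addRight (1 : ZMod v))
    generalize orderOf (Equiv.addRight (1 : ZMod v)) = m at h ⊢
    simpa using Equiv.congr_fun h 0

end Configuration

section PGroup

variable {p n : ℕ} {P : Subgroup (Equiv.Perm (ZMod (p ^ n)))}

lemma IsPGroup.exists_pow_eq_one_of_mem (hP : IsPGroup p P) {g : Equiv.Perm (ZMod (p ^ n))}
    (hg : g ∈ P) : ∃ m : ℕ, g ^ p ^ m = 1 := by
  obtain ⟨m, hm⟩ := hP ⟨g, hg⟩
  exact ⟨m, congrArg Subtype.val hm⟩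

lemma IsPGroup.apply_add_of_natCast_mul_eq_zero (hP : IsPGroup p P) (hp : p.Prime) (hn : n ≠ 0)
    (hT : Equiv.addRight 1 ∈ P) {g : Equiv.Perm (ZMod (p ^ n))} (hg : g ∈ P) (x : ZMod (p ^ n))
    {c : ZMod (p ^ n)} (hc : (p : ZMod (p ^ n)) * c = 0) : g (x + c) = g x + c := by
  have := Fact.mk hp
  have : Fact (1 < p ^ n) := ⟨Nat.one_lt_pow hn hp.one_lt⟩
  have : NeZero (p ^ n) := ⟨by positivity [hp.pos]⟩
  have hnt : Nontrivial P := ⟨⟨_, hT⟩, 1, fun h => by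
    have := Equiv.congr_fun (congrArg Subtype.val h) (0 : ZMod (p ^ n))
    simp at this⟩
  have := hP.center_nontrivial
  obtain ⟨⟨ζ, hζ⟩, hζ1⟩ := exists_ne (1 : Subgroup.center P)
  rw [Subgroup.mem_center_iff] at hζ
  have hcomm : ∀ g ∈ P, ∀ x, g (ζ.1 x) = ζ.1 (g x) := fun g hg x =>
    Equiv.congr_fun (congrArg Subtype.val (hζ ⟨g, hg⟩)) x
  have hζx : ∀ x, ζ.1 x = x + ζ.1 0 := fun x => by
    simpa using ZMod.eq_mul_add_of_map_add_one (f := ζ.1) (w := 1)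
      (fun x => (hcomm _ hT x).symm) x
  have hw : ζ.1 0 ≠ 0 := by
    intro h
    apply hζ1
    ext x
    simp [hζx x, h]
  obtain ⟨d, rfl⟩ := ZMod.dvd_of_natCast_mul_eq_zero hp hw hc
  have hg' : ∀ x, g (x + ζ.1 0) = g x + ζ.1 0 := fun x => by
    rw [← hζx, hcomm g hg, hζx]
  have h : ∀ m : ℕ, g (x + ζ.1 0 * m) = g x + ζ.1 0 * m := by
    intro m
    induction m with
    | zero => simp
    | succ m ih => push_cast; rw [mul_add, mul_one, ← add_assoc, hg', ih, add_assoc]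
  simpa using h d.val

variable {S : Finset (ZMod (p ^ n))}

lemma IsPGroup.eq_one_or_of_apply_eq_mul (hP : IsPGroup p P) (hp : p.Prime) (hn : n ≠ 0)
    (hT : Equiv.addRight 1 ∈ P) (hPS : ∀ g ∈ P, g • confLines _ S = confLines _ S)
    (hS : HasDistinctDifferences S) (hk : 3 ≤ S.card)
    (hconn : AddSubgroup.closure ((S : Set (ZMod (p ^ n))) - (S : Set (ZMod (p ^ n)))) = ⊤)
    {g : Equiv.Perm (ZMod (p ^ n))} (hg : g ∈ P) {u : ZMod (p ^ n)} (hgu : ∀ x, g x = u * x) :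
    u = 1 ∨ p = 2 ∧ u ^ 2 = 1 ∧ 2 * (u + 1) = 0 := by
  have : NeZero (p ^ n) := ⟨by positivity [hp.pos]⟩
  have hpow : ∀ (i : ℕ) x, (g ^ i) x = u ^ i * x := by
    intro i
    induction i with
    | zero => simp
    | succ i ih => intro x; rw [pow_succ, Equiv.Perm.mul_apply, ih, hgu]; ring
  obtain ⟨m, hm⟩ := hP.exists_pow_eq_one_of_mem hg
  refine ZMod.eq_one_or_of_pow_eq_one hp hn (m := m) ?_ fun i hi => ?_
  · simpa [hm] using (hpow (p ^ m) 1).symm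
  · obtain ⟨w, hw⟩ := hS.exists_eq_add_of_nsmul_eq hk hconn hp
      (fun x => ⟨n, by rw [nsmul_eq_mul, ZMod.natCast_self, zero_mul]⟩) (g := g ^ i)
      (exists_forall_sub_mem_iff (hPS _ (pow_mem hg i)))
      (fun x c hc => hP.apply_add_of_natCast_mul_eq_zero hp hn hT (pow_mem hg i) x
        (by rwa [nsmul_eq_mul] at hc))
      (fun x => by
        rw [hpow, nsmul_eq_mul, nsmul_eq_mul]
        linear_combination x * hi)
    have h0 := hw 0
    have h1 := hw 1
    rw [hpow, mul_zero, zero_add] at h0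
    rwa [hpow, mul_one, ← h0, add_zero] at h1

lemma IsPGroup.eq_one_of_apply_eq_mul_add (hP : IsPGroup p P) (hp : p.Prime) (hn : n ≠ 0)
    (hn2 : p = 2 → 3 ≤ n)
    (hT : Equiv.addRight 1 ∈ P) (hPS : ∀ g ∈ P, g • confLines _ S = confLines _ S)
    (hS : HasDistinctDifferences S) (hk : 3 ≤ S.card)
    (hconn : AddSubgroup.closure ((S : Set (ZMod (p ^ n))) - (S : Set (ZMod (p ^ n)))) = ⊤)
    {g : Equiv.Perm (ZMod (p ^ n))} (hg : g ∈ P) (ho : orderOf g = p ^ n) {u b : ZMod (p ^ n)}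
    (hgu : ∀ x, g x = u * x + b) : u = 1 := by
  have : NeZero (p ^ n) := ⟨by positivity [hp.pos]⟩
  have hb : Equiv.addRight (-b) ∈ P := by
    have : Equiv.addRight (-b) = Equiv.addRight 1 ^ (-b).val := by ext x; simp
    exact this ▸ pow_mem hT _
  rcases hP.eq_one_or_of_apply_eq_mul hp hn hT hPS hS hk hconn (mul_mem hb hg) (u := u)
    (fun x => by simp [hgu]) with h | ⟨rfl, h1, h2⟩
  · exact h
  · exfalso
    have h4 : g ^ 4 = 1 := by
      ext x
      simp only [pow_succ, pow_zero, one_mul, Equiv.Perm.mul_apply, hgu, Equiv.Perm.one_apply]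
      linear_combination (u ^ 2 * x + x + (u + 1) * b) * h1 + b * h2
    have := orderOf_dvd_of_pow_eq_one h4
    rw [ho, show 4 = 2 ^ 2 from rfl, Nat.pow_dvd_pow_iff_le_right (by norm_num)] at this
    have := hn2 rfl
    omega

/-- The translations are the only elements of order `p ^ n` of a `p`-group of automorphisms of a
connected balanced cyclic configuration containing all translations. -/
lemma IsPGroup.exists_eq_add_of_orderOf_eq (hP : IsPGroup p P) (hp : p.Prime) (hn : n ≠ 0)
    (hn2 : p = 2 → 3 ≤ n)
    (hT : Equiv.addRight 1 ∈ P) (hPS : ∀ g ∈ P, g • confLines _ S = confLines _ S)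
    (hS : HasDistinctDifferences S) (hk : 3 ≤ S.card)
    (hconn : AddSubgroup.closure ((S : Set (ZMod (p ^ n))) - (S : Set (ZMod (p ^ n)))) = ⊤)
    {g : Equiv.Perm (ZMod (p ^ n))} (hg : g ∈ P) (ho : orderOf g = p ^ n) :
    ∃ w, ∀ x, g x = x + w := by
  have := Fact.mk hp
  have : NeZero (p ^ n) := ⟨by positivity [hp.pos]⟩
  let τ : P := ⟨Equiv.addRight 1, hT⟩
  let N : Subgroup P := Subgroup.normalizer (Subgroup.zpowers τ : Set P)
  have hmem : ∀ h : P, (∃ w, ∀ x, h.1 x = x + w) → h ∈ Subgroup.zpowers τ := by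
    rintro h ⟨w, hw⟩
    have : h = τ ^ w.val := by
      ext x
      simp [τ, hw]
    exact this ▸ Subgroup.npow_mem_zpowers τ _
  have htrans : ∀ h ∈ Subgroup.zpowers τ, ∃ w, ∀ x, h.1 x = x + w := by
    intro h hh
    obtain ⟨m, rfl⟩ := (Submonoid.mem_powers_iff _ _).1 (mem_powers_iff_mem_zpowers.2 hh)
    exact ⟨m, fun x => by simp [τ]⟩
  have hNmem : ∀ h : P, h * τ * h⁻¹ ∈ Subgroup.zpowers τ → h ∈ N := by
    intro h hh
    refine Subgroup.mem_normalizer_fintype fun y hy => ?_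
    obtain ⟨m, rfl⟩ := Subgroup.mem_zpowers_iff.1 hy
    rw [← conj_zpow]
    exact zpow_mem hh m
  have hNorder : ∀ h ∈ N, orderOf h = p ^ n → h ∈ Subgroup.zpowers τ := by
    intro h hh ho
    obtain ⟨w, hw⟩ := htrans _
      ((Subgroup.mem_normalizer_iff.1 hh τ).1 (Subgroup.mem_zpowers τ))
    have haff : ∀ x, h.1 x = w * x + h.1 0 := ZMod.eq_mul_add_of_map_add_one fun x => by
      simpa [τ] using hw (h.1 x)
    have h1 := hP.eq_one_of_apply_eq_mul_add hp hn hn2 hT hPS hS hk hconn h.2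
      ((Subgroup.orderOf_coe h).trans ho) haff
    exact hmem h ⟨h.1 0, fun x => by rw [haff, h1, one_mul]⟩
  have hτ : orderOf τ = p ^ n := by
    rw [← Subgroup.orderOf_coe, ZMod.orderOf_addRight_one]
  have hN : N = ⊤ := by
    have := hP.isNilpotent
    refine normalizerCondition_iff_only_full_group_self_normalizing.1
      Group.normalizerCondition_of_isNilpotent N (le_antisymm (fun h hh => ?_)
      Subgroup.le_normalizer)
    refine hNmem h (hNorder _ ((Subgroup.mem_normalizer_iff.1 hh τ).1
      (Subgroup.le_normalizer (Subgroup.mem_zpowers τ))) ?_)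
    exact (orderOf_injective (MulAut.conj h).toMonoidHom (MulAut.conj h).injective τ).trans hτ
  exact htrans ⟨g, hg⟩ (hNorder _ (hN ▸ Subgroup.mem_top _)
    ((Subgroup.orderOf_coe ⟨g, hg⟩).symm.trans ho))

end PGroup

/-- An isomorphism between connected balanced cyclic configurations can be replaced by an affine
one. -/
lemma exists_isUnit_of_smul_confLines_eq {p n : ℕ} (hp : p.Prime) (hn : n ≠ 0)
    (hn2 : p = 2 → 3 ≤ n) {S₁ S₂ : Finset (ZMod (p ^ n))}
    (hS : HasDistinctDifferences S₂) (hk : 3 ≤ S₂.card)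
    (hconn : AddSubgroup.closure ((S₂ : Set (ZMod (p ^ n))) - (S₂ : Set (ZMod (p ^ n)))) = ⊤)
    {σ : Equiv.Perm (ZMod (p ^ n))} (hσ : σ • confLines _ S₁ = confLines _ S₂) :
    ∃ u b : ZMod (p ^ n), IsUnit u ∧ ∀ x, x ∈ S₁ ↔ u * x + b ∈ S₂ := by
  have := Fact.mk hp
  have : NeZero (p ^ n) := ⟨by positivity [hp.pos]⟩
  let A := MulAction.stabilizer (Equiv.Perm (ZMod (p ^ n))) (confLines _ S₂)
  have hτA : Equiv.addRight 1 ∈ A := addRight_smul_confLines S₂ 1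
  have hτ'A : σ * Equiv.addRight 1 * σ⁻¹ ∈ A := by
    change (σ * Equiv.addRight 1 * σ⁻¹) • confLines _ S₂ = confLines _ S₂
    rw [← hσ, mul_smul, inv_smul_smul, mul_smul, addRight_smul_confLines]
  have hconj : ∀ h : Equiv.Perm (ZMod (p ^ n)), orderOf (h * Equiv.addRight 1 * h⁻¹) = p ^ n :=
    fun h => (orderOf_injective (MulAut.conj h).toMonoidHom (MulAut.conj h).injective
      (Equiv.addRight 1)).trans ZMod.orderOf_addRight_one
  have hpgroup : ∀ a : A, orderOf a = p ^ n → IsPGroup p (Subgroup.zpowers a) := fun a ha =>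
    IsPGroup.of_card (n := n) (by rw [Nat.card_zpowers, ha])
  obtain ⟨P, hP⟩ := (hpgroup ⟨_, hτA⟩ (by
    rw [← Subgroup.orderOf_coe, ZMod.orderOf_addRight_one])).exists_le_sylow
  obtain ⟨P', hP'⟩ := (hpgroup ⟨_, hτ'A⟩ (by rw [← Subgroup.orderOf_coe, hconj])).exists_le_sylow
  obtain ⟨α, rfl⟩ := MulAction.exists_smul_eq A P' P
  have hg : α.1 * (σ * Equiv.addRight 1 * σ⁻¹) * α.1⁻¹ ∈
      ((α • P' : Sylow p A) : Subgroup A).map A.subtype :=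
    ⟨α * ⟨_, hτ'A⟩ * α⁻¹, ⟨_, hP' (Subgroup.mem_zpowers _), rfl⟩, rfl⟩
  have hassoc : α.1 * (σ * Equiv.addRight 1 * σ⁻¹) * α.1⁻¹ =
      (α.1 * σ) * Equiv.addRight 1 * (α.1 * σ)⁻¹ := by group
  rw [hassoc] at hg
  obtain ⟨w, hw⟩ := ((α • P').isPGroup'.map A.subtype).exists_eq_add_of_orderOf_eq hp hn hn2
    ⟨_, hP (Subgroup.mem_zpowers _), rfl⟩ (by rintro _ ⟨a, _, rfl⟩; exact a.2) hS hk hconn hg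
    (hconj _)
  have haff : ∀ x, (α.1 * σ) x = w * x + (α.1 * σ) 0 := ZMod.eq_mul_add_of_map_add_one fun x => by
    simpa using hw ((α.1 * σ) x)
  have hασ : (α.1 * σ) • confLines _ S₁ = confLines _ S₂ := by
    rw [mul_smul, hσ]
    exact α.2
  obtain ⟨j, hj⟩ := exists_forall_sub_mem_iff hασ 0
  refine ⟨w, (α.1 * σ) 0 - j, ?_, fun x => ?_⟩
  · obtain ⟨y, hy⟩ := (α.1 * σ).surjective ((α.1 * σ) 0 + 1)
    rw [haff] at hy
    exact IsUnit.of_mul_eq_one y (by linear_combination hy)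
  · rw [← sub_zero x, hj, haff]
    simp [add_sub_assoc]

section Reduction

lemma IsAddCyclic.addSubgroup_eq_of_card_eq {G : Type*} [AddCommGroup G] [Finite G] [IsAddCyclic G]
    {H K : AddSubgroup G} (h : Nat.card H = Nat.card K) : H = K := by
  classical
  have := Fintype.ofFinite G
  have key : ∀ L : AddSubgroup G,
      (L : Set G).toFinset = Finset.univ.filter fun d : G => Nat.card L • d = 0 := by
    intro L
    refine Finset.eq_of_subset_of_card_le (fun x hx => ?_) ?_
    · rw [Set.mem_toFinset] at hx
      rw [Finset.mem_filter]
      exact ⟨Finset.mem_univ _, congrArg Subtype.val (card_nsmul_eq_zero' (x := (⟨x, hx⟩ : L)))⟩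
    · refine (IsAddCyclic.card_nsmul_eq_zero_le (α := G) Nat.card_pos).trans ?_
      rw [Set.toFinset_card, ← Nat.card_eq_fintype_card]
      rfl
  rw [← SetLike.coe_set_eq, ← Set.toFinset_inj, key, key, h]

lemma ZMod.exists_injective_range_eq {p n : ℕ} (hp : p.Prime) (H : AddSubgroup (ZMod (p ^ n))) :
    ∃ (m : ℕ) (ι : ZMod (p ^ m) →+ ZMod (p ^ n)), Function.Injective ι ∧ ι.range = H := by
  obtain ⟨m, -, hm⟩ := (Nat.dvd_prime_pow hp).1
    ((AddSubgroup.card_addSubgroup_dvd_card H).trans (Nat.card_zmod _).dvd)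
  have e : ZMod (Nat.card H) ≃+ H := zmodAddCyclicAddEquiv inferInstance
  rw [hm] at e
  refine ⟨m, H.subtype.comp e.toAddMonoidHom, H.subtype_injective.comp e.injective, ?_⟩
  ext x
  exact ⟨fun ⟨y, hy⟩ => hy ▸ (e y).2, fun hx => ⟨e.symm ⟨x, hx⟩, by simp⟩⟩

lemma HasDistinctDifferences.card_mul_card_sub_one_le {G : Type*} [AddCommGroup G] [Finite G]
    {S : Finset G} (hS : HasDistinctDifferences S) :
    S.card * S.card - S.card ≤ Nat.card G := by
  classical
  have := Fintype.ofFinite G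
  rw [← Finset.offDiag_card, Nat.card_eq_fintype_card, ← Finset.card_univ]
  refine Finset.card_le_card_of_injOn (fun x => x.1 - x.2) (fun _ _ => by simp) ?_
  rintro ⟨a, b⟩ hab ⟨c, d⟩ hcd h
  simp only [Finset.coe_offDiag, Set.mem_offDiag, Finset.mem_coe] at hab hcd
  exact Prod.ext_iff.2 (hS a hab.1 b hab.2.1 c hcd.1 d hcd.2.1 hab.2.2 h)

variable {v : ℕ}

lemma exists_forall_sub_mem_iff_right {S₁ S₂ : Finset (ZMod v)} {σ : Equiv.Perm (ZMod v)}
    (h : σ • confLines v S₁ = confLines v S₂) (j : ZMod v) :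
    ∃ i, ∀ x, x - i ∈ S₁ ↔ σ x - j ∈ S₂ := by
  obtain ⟨i, hi⟩ := exists_forall_sub_mem_iff (S₁ := S₂) (S₂ := S₁) (σ := σ⁻¹)
    (by rw [← h, inv_smul_smul]) j
  exact ⟨i, fun x => by simpa using (hi (σ x)).symm⟩

lemma apply_add_sub_apply_mem_closure {S₁ S₂ : Finset (ZMod v)} {σ : Equiv.Perm (ZMod v)}
    (hσ : σ • confLines v S₁ = confLines v S₂) {h : ZMod v}
    (hh : h ∈ AddSubgroup.closure ((S₁ : Set (ZMod v)) - (S₁ : Set (ZMod v)))) (x : ZMod v) :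
    σ (x + h) - σ x ∈ AddSubgroup.closure ((S₂ : Set (ZMod v)) - (S₂ : Set (ZMod v))) := by
  induction hh using AddSubgroup.closure_induction generalizing x with
  | mem h hh =>
    obtain ⟨s, hs, t, ht, rfl⟩ := Set.mem_sub.1 hh
    obtain ⟨j, hj⟩ := exists_forall_sub_mem_iff hσ (x - t)
    have h1 := (hj x).1 (by simpa using ht)
    have h2 := (hj (x + (s - t))).1 (by rwa [show x + (s - t) - (x - t) = s by abel])
    simpa using AddSubgroup.subset_closure (Set.sub_mem_sub h2 h1)
  | zero => simp
  | add a b _ _ ha hb =>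
    have := add_mem (hb (x + a)) (ha x)
    rwa [sub_add_sub_cancel, add_assoc] at this
  | neg a _ ha =>
    have := neg_mem (ha (x + -a))
    rwa [neg_sub, neg_add_cancel_right] at this

lemma closure_sub_eq_of_smul_confLines_eq [NeZero v] {S₁ S₂ : Finset (ZMod v)}
    {σ : Equiv.Perm (ZMod v)} (hσ : σ • confLines v S₁ = confLines v S₂) :
    AddSubgroup.closure ((S₁ : Set (ZMod v)) - (S₁ : Set (ZMod v))) =
      AddSubgroup.closure ((S₂ : Set (ZMod v)) - (S₂ : Set (ZMod v))) := by
  have key : ∀ {S₁ S₂ : Finset (ZMod v)} {σ : Equiv.Perm (ZMod v)},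
      σ • confLines v S₁ = confLines v S₂ →
      Nat.card (AddSubgroup.closure ((S₁ : Set (ZMod v)) - (S₁ : Set (ZMod v)))) ≤
        Nat.card (AddSubgroup.closure ((S₂ : Set (ZMod v)) - (S₂ : Set (ZMod v)))) := by
    intro S₁ S₂ σ hσ
    refine Nat.card_le_card_of_injective
      (fun h => ⟨σ (0 + h.1) - σ 0, apply_add_sub_apply_mem_closure hσ h.2 0⟩) fun a b hab => ?_
    simpa using hab
  exact IsAddCyclic.addSubgroup_eq_of_card_eq
    (le_antisymm (key hσ) (key (σ := σ⁻¹) (by rw [← hσ, inv_smul_smul])))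

/-- Isomorphic balanced cyclic configurations of prime power order are multiplier equivalent. -/
lemma multEquiv_of_smul_confLines_eq {p n : ℕ} (hp : p.Prime) {S₁ S₂ : Finset (ZMod (p ^ n))}
    (hcard : S₁.card = S₂.card) (hk : 3 ≤ S₂.card) (hS : HasDistinctDifferences S₂)
    {σ : Equiv.Perm (ZMod (p ^ n))} (hσ : σ • confLines _ S₁ = confLines _ S₂) :
    MultEquiv (p ^ n) S₁ S₂ := by
  have : NeZero (p ^ n) := ⟨by positivity [hp.pos]⟩
  have hcl := closure_sub_eq_of_smul_confLines_eq hσ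
  obtain ⟨m, ι, hι, hrange⟩ := ZMod.exists_injective_range_eq hp
    (AddSubgroup.closure ((S₂ : Set (ZMod (p ^ n))) - (S₂ : Set (ZMod (p ^ n)))))
  have : NeZero (p ^ m) := ⟨by positivity [hp.pos]⟩
  have hsub₂ : ∀ {s t}, s ∈ S₂ → t ∈ S₂ → ∃ x, ι x = s - t := fun hs ht => by
    rw [← AddMonoidHom.mem_range, hrange]
    exact AddSubgroup.subset_closure (Set.sub_mem_sub hs ht)
  have hsub₁ : ∀ {s t}, s ∈ S₁ → t ∈ S₁ → ∃ x, ι x = s - t := fun hs ht => by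
    rw [← AddMonoidHom.mem_range, hrange, ← hcl]
    exact AddSubgroup.subset_closure (Set.sub_mem_sub hs ht)
  have hσι : ∀ x, ∃ y, ι y = σ (ι x) - σ 0 := fun x => by
    rw [← AddMonoidHom.mem_range, hrange]
    simpa using apply_add_sub_apply_mem_closure hσ (h := ι x) (by rw [hcl, ← hrange]; simp) 0
  choose f hf using hσι
  have hfinj : Function.Injective f := fun x y hxy => hι (σ.injective (by
    simpa [hf] using congrArg ι hxy))
  let ρ : Equiv.Perm (ZMod (p ^ m)) := Equiv.ofBijective f (Finite.injective_iff_bijective.1 hfinj)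
  have hρ : ∀ x, σ (ι x) = ι (ρ x) + σ 0 := fun x => by simp [ρ, hf]
  obtain ⟨s₁, hs₁⟩ := Finset.card_pos.1 (by omega : 0 < S₁.card)
  obtain ⟨s₂, hs₂⟩ := Finset.card_pos.1 (by omega : 0 < S₂.card)
  let R₁ : Finset (ZMod (p ^ m)) := Finset.univ.filter fun x => ι x + s₁ ∈ S₁
  let R₂ : Finset (ZMod (p ^ m)) := Finset.univ.filter fun x => ι x + s₂ ∈ S₂
  have hR₁ : ∀ x, x ∈ R₁ ↔ ι x + s₁ ∈ S₁ := by simp [R₁]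
  have hR₂ : ∀ x, x ∈ R₂ ↔ ι x + s₂ ∈ S₂ := by simp [R₂]
  have himage : R₂.image (fun x => ι x + s₂) = S₂ := by
    ext s
    simp only [Finset.mem_image, hR₂]
    refine ⟨fun ⟨x, hx, h⟩ => h ▸ hx, fun hs => ?_⟩
    obtain ⟨x, hx⟩ := hsub₂ hs hs₂
    exact ⟨x, by rwa [hx, sub_add_cancel], by rw [hx, sub_add_cancel]⟩
  have hRcard : R₂.card = S₂.card := by
    have := Finset.card_image_of_injective R₂ (f := fun x => ι x + s₂)
      fun x y h => hι (add_right_cancel h)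
    rw [himage] at this
    exact this.symm
  have hRS : HasDistinctDifferences R₂ := by
    intro a ha b hb c hc d hd hab h
    have := hS _ ((hR₂ a).1 ha) _ ((hR₂ b).1 hb) _ ((hR₂ c).1 hc) _ ((hR₂ d).1 hd)
      (fun h => hab (hι (add_right_cancel h)))
      (by rw [add_sub_add_right_eq_sub, add_sub_add_right_eq_sub, ← map_sub, h, map_sub])
    exact ⟨hι (add_right_cancel this.1), hι (add_right_cancel this.2)⟩
  have hRconn : AddSubgroup.closure ((R₂ : Set (ZMod (p ^ m))) - (R₂ : Set (ZMod (p ^ m)))) =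
      ⊤ := by
    apply AddSubgroup.map_injective hι
    rw [AddMonoidHom.map_closure, ← AddMonoidHom.range_eq_map, hrange]
    congr 1
    ext z
    simp only [Set.mem_image, Set.mem_sub, Finset.mem_coe]
    constructor
    · rintro ⟨_, ⟨x, hx, y, hy, rfl⟩, rfl⟩
      exact ⟨_, (hR₂ x).1 hx, _, (hR₂ y).1 hy, by rw [add_sub_add_right_eq_sub, map_sub]⟩
    · rintro ⟨s, hs, t, ht, rfl⟩
      rw [← himage] at hs ht
      obtain ⟨x, hx, rfl⟩ := Finset.mem_image.1 hs
      obtain ⟨y, hy, rfl⟩ := Finset.mem_image.1 ht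
      exact ⟨_, ⟨x, hx, y, hy, rfl⟩, by rw [add_sub_add_right_eq_sub, map_sub]⟩
  have hρσ : ρ • confLines _ R₁ = confLines _ R₂ := by
    have key : ∀ i j, (∀ x, x - (ι i - s₁) ∈ S₁ ↔ σ x - (ι j + σ 0 - s₂) ∈ S₂) →
        ∀ x, x - i ∈ R₁ ↔ ρ x - j ∈ R₂ := by
      intro i j h x
      rw [hR₁, hR₂, map_sub, map_sub, sub_add, h, hρ]
      congr! 1
      abel
    refine smul_confLines_eq (fun i => ?_) fun j => ?_
    · obtain ⟨J, hJ⟩ := exists_forall_sub_mem_iff hσ (ι i - s₁)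
      obtain ⟨y, hy⟩ := hsub₂ ((hJ (ι i)).1 (by simpa using hs₁)) hs₂
      refine ⟨ρ i - y, key _ _ ?_⟩
      rwa [map_sub, hy, hρ, show ι (ρ i) - (ι (ρ i) + σ 0 - J - s₂) + σ 0 - s₂ = J by abel]
    · obtain ⟨I, hI⟩ := exists_forall_sub_mem_iff_right hσ (ι j + σ 0 - s₂)
      obtain ⟨x, rfl⟩ := ρ.surjective j
      obtain ⟨y, hy⟩ := hsub₁ ((hI (ι x)).2 (by rw [hρ]; simpa using hs₂)) hs₁
      refine ⟨x - y, key _ _ ?_⟩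
      rwa [map_sub, hy, show ι x - (ι x - I - s₁) - s₁ = I by abel]
  have hm6 : 6 ≤ p ^ m := by
    have h1 := hRS.card_mul_card_sub_one_le
    rw [Nat.card_zmod] at h1
    have h2 : R₂.card * 3 ≤ R₂.card * R₂.card := Nat.mul_le_mul_left _ (hRcard ▸ hk)
    omega
  have hm : m ≠ 0 := by rintro rfl; simp at hm6
  have hm2 : p = 2 → 3 ≤ m := by
    rintro rfl
    by_contra h
    have := Nat.pow_le_pow_right (n := 2) (by norm_num) (by omega : m ≤ 2)
    omega
  obtain ⟨u, b, hu, hub⟩ :=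
    exists_isUnit_of_smul_confLines_eq hp hm hm2 hRS (hRcard ▸ hk) hRconn hρσ
  have hU : IsUnit ((u.val : ℕ) : ZMod (p ^ n)) := by
    rw [← ZMod.natCast_zmod_val u, ZMod.isUnit_iff_coprime,
      Nat.coprime_pow_right_iff (Nat.pos_of_ne_zero hm)] at hu
    rw [ZMod.isUnit_iff_coprime]
    exact hu.pow_right n
  obtain ⟨U, hU⟩ := hU
  have hιu : ∀ x, ι (u * x) = U * ι x := fun x => by
    conv_lhs => rw [← ZMod.natCast_zmod_val u, ← nsmul_eq_mul, map_nsmul, nsmul_eq_mul, ← hU]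
  have himage' : S₁.image (fun y => U * (y - s₁) + (ι b + s₂)) = S₂ := by
    refine Finset.eq_of_subset_of_card_le (fun z hz => ?_) ?_
    · obtain ⟨y, hy, rfl⟩ := Finset.mem_image.1 hz
      obtain ⟨x, hx⟩ := hsub₁ hy hs₁
      have := (hR₂ _).1 ((hub x).1 ((hR₁ x).2 (by rwa [hx, sub_add_cancel])))
      rwa [map_add, hιu, hx, add_assoc] at this
    · rw [Finset.card_image_of_injective, hcard]
      intro x y hxy
      simpa using hxy
  refine ⟨U⁻¹, s₁ - U⁻¹ * (ι b + s₂), ?_⟩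
  conv_rhs => rw [← himage', Finset.image_image]
  conv_lhs => rw [← Finset.image_id (s := S₁)]
  refine Finset.image_congr fun y _ => ?_
  simp only [id, Function.comp, mul_add, Units.inv_mul_cancel_left]
  ring

lemma MultEquiv.confIso {S₁ S₂ : Finset (ZMod v)} (h : MultEquiv v S₁ S₂) : ConfIso v S₁ S₂ := by
  obtain ⟨a, b, rfl⟩ := h
  have key : ∀ i j x : ZMod v, a * j = i + b →
      (x - i ∈ S₂.image (fun x => (a : ZMod v) * x + b) ↔ Units.mulLeft a⁻¹ x - j ∈ S₂) := by
    intro i j x hij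
    have hx : x - i = a * (a⁻¹ * x - j) + b := by
      rw [mul_sub, Units.mul_inv_cancel_left, hij]
      ring
    rw [hx, Finset.mem_image]
    simp
  exact ⟨Units.mulLeft a⁻¹, smul_confLines_eq
    (fun i => ⟨a⁻¹ * (i + b), fun x => key _ _ _ (by simp)⟩)
    fun j => ⟨a * j - b, fun x => key _ _ _ (by simp)⟩⟩

end Reduction

/-- Theorem B, case `v = pⁿ`: for `v` a prime power,
two balanced cyclic configurations of type (v_k) are isomorphic iff they are
multiplier equivalent. -/
theorem confIso_iff_multEquiv_of_eq_prime_pow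
    (p n : ℕ) (hp : p.Prime) (hn : 1 ≤ n)
    (v : ℕ) (hv : v = p ^ n) (k : ℕ) (hk : 3 ≤ k)
    (S₁ S₂ : Finset (ZMod v))
    (hcard₁ : S₁.card = k) (hdiff₁ : (S₁ - S₁).card = k ^ 2 - k + 1)
    (hcard₂ : S₂.card = k) (hdiff₂ : (S₂ - S₂).card = k ^ 2 - k + 1) :
    ConfIso v S₁ S₂ ↔ MultEquiv v S₁ S₂ := by
  subst hv
  constructor
  · rintro ⟨σ, hσ⟩
    exact multEquiv_of_smul_confLines_eq hp (hcard₁.trans hcard₂.symm) (hcard₂ ▸ hk)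
      (hasDistinctDifferences_of_card_sub hcard₂ hdiff₂) hσ
  · exact MultEquiv.confIso
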